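/- For any vector (finite sequence) K of natural numbers and any natural numbers a and b, the polynomials over Łukasiewicz paths with prescribed profile satisfy C̃_{K·(a)}(q,t) = C̃_{K·(b)}(q,t), where K·(a) denotes the sequence K with the entry a appended at the end. -/

import Mathlib

/-! ## Plane trees -/

/-- A plane tree: a root together with an ordered (left-to-right) list of subtrees.
A node is a *leaf* if it has no children, and *internal* otherwise. -/
inductive PTree : Type where
  | node : List PTree → PTree


namespace Luka

/-! ## Łukasiewicz paths

A path is encoded by its list of step increments: the step `(1,k)` (an up-step `U_k` of
degree `k`) is encoded by `k : ℤ` with `k ≥ 0`, and the down step `D = (1,-1)` by `-1`. -/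

/-- `P` is a Łukasiewicz path: it is nonempty, uses steps `(1,k)` with `k ≥ -1`,
stays (weakly) above the `x`-axis before its last step, and ends at height `-1`
(so that it goes strictly below the axis only at the last step, which is forced
to be the down-step `D`). -/
def IsLukas (P : List ℤ) : Prop :=
  P ≠ [] ∧ (∀ s ∈ P, -1 ≤ s) ∧ (∀ n, n < P.length → 0 ≤ (P.take n).sum) ∧ P.sum = -1

/-- The degrees of the up-steps of `P`, from left to right (the *profile* of `P`). -/
def upDegs (P : List ℤ) : List ℕ := (P.filter (fun s => 0 ≤ s)).map Int.toNat

/-- The profile multiset `𝔐(P)`: the multiset of degrees of the up-steps of `P`. -/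
def profileM (P : List ℤ) : Multiset ℕ := (upDegs P : Multiset ℕ)

/-- The degree of the first up-step of `P`, if any. -/
def firstUp? (P : List ℤ) : Option ℕ := (upDegs P).head?

/-- The degree of the last up-step of `P`, if any. -/
def lastUp? (P : List ℤ) : Option ℕ := (upDegs P).getLast?

/-- Auxiliary: starting from height `h`, record the starting height of every up-step. -/
def areaVecAux : ℤ → List ℤ → List ℤ
  | _, [] => []
  | h, s :: rest => (if 0 ≤ s then [h] else []) ++ areaVecAux (h + s) rest

/-- The area vector `Area(P)`: the `i`-th entry is the `y`-coordinate of the starting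
point of the `i`-th up-step of `P`. -/
def areaVec (P : List ℤ) : List ℤ := areaVecAux 0 P

/-- `area(P)`: the sum of the entries of the area vector (entries of a Łukasiewicz
path are nonnegative, so taking `Int.toNat` entrywise is harmless). -/
def area (P : List ℤ) : ℕ := ((areaVec P).map Int.toNat).sum

/-- Auxiliary computation of the depth values: `cur` is the depth value of the previous
step (`0` initially), and `stack` holds the pending depth values of the future matching
down-steps (top of the stack = value for the next matching down-step to come).
Reading an up-step `U_k` whose value is `cur` (inherited from the previous step) pushes
the values `cur+1, …, cur+k` for its `k` matching down-steps (its first matching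
down-step, which crosses its topmost interior level, gets `cur+1`, etc.); reading a
down-step pops its value.  The list returned records the value `d_i` of each up-step,
from left to right. -/
def depthVecAux : ℕ → List ℕ → List ℤ → List ℕ
  | _, _, [] => []
  | cur, stack, s :: rest =>
    if 0 ≤ s then
      cur :: depthVecAux cur ((List.range s.toNat).map (fun i => cur + i + 1) ++ stack) rest
    else
      match stack with
      | [] => depthVecAux cur [] rest
      | v :: st => depthVecAux v st rest

/-- The depth vector `Depth(P)`: the values `d_i` at the up-steps of `P`, left to right. -/
def depthVec (P : List ℤ) : List ℕ := depthVecAux 0 [] P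

/-- `depth(P)`: the sum of the entries of the depth vector. -/
def depth (P : List ℤ) : ℕ := (depthVec P).sum

/-- `P ∈ 𝓛_M`. -/
def MemL (M : Multiset ℕ) (P : List ℤ) : Prop := IsLukas P ∧ profileM P = M

/-- `P ∈ 𝓛_{a,M}`: first up-step of degree `a`, profile multiset `M ⊎ {a}`. -/
def MemLa (a : ℕ) (M : Multiset ℕ) (P : List ℤ) : Prop :=
  IsLukas P ∧ firstUp? P = some a ∧ profileM P = a ::ₘ M

/-- `P ∈ 𝓛_{M,b}`: last up-step of degree `b`, profile multiset `M ⊎ {b}`. -/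
def MemLb (M : Multiset ℕ) (b : ℕ) (P : List ℤ) : Prop :=
  IsLukas P ∧ lastUp? P = some b ∧ profileM P = b ::ₘ M

/-- `P ∈ 𝓛_{a,M,b}`: first up-step of degree `a`, last up-step of degree `b`,
profile multiset `M ⊎ {a, b}`. -/
def MemLab (a : ℕ) (M : Multiset ℕ) (b : ℕ) (P : List ℤ) : Prop :=
  IsLukas P ∧ firstUp? P = some a ∧ lastUp? P = some b ∧ profileM P = a ::ₘ b ::ₘ M

/-! ## Plane-tree statistics -/

/-- The (ordered) children of the root of a plane tree. -/
def children : PTree → List PTree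
  | .node ts => ts

/-- The degree of (the root of) a plane tree: its number of children. -/
def numChildren (t : PTree) : ℕ := (children t).length

mutual
/-- Number of internal nodes of a plane tree. -/
def internCount : PTree → ℕ
  | .node [] => 0
  | .node (t :: ts) => 1 + internCountL (t :: ts)
def internCountL : List PTree → ℕ
  | [] => 0
  | t :: ts => internCount t + internCountL ts
end

mutual
/-- `lthornT T` = the sum of `lthorn(u)` over all internal nodes `u` of `T`, where
`lthorn(u)` is the number of descending edges of strict ancestors `v` of `u` lying to
the left of the path from `v` to `u`.  (Every internal node of the subtree rooted at
the `i`-th child (0-indexed) of a node gains `i` left thorns from that node.) -/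
def lthornT : PTree → ℕ
  | .node ts => lthornL 0 ts
def lthornL : ℕ → List PTree → ℕ
  | _, [] => 0
  | i, t :: ts => lthornT t + i * internCount t + lthornL (i + 1) ts
end

mutual
/-- `rthornT T` = the sum of `rthorn(u)` over all internal nodes `u` of `T`, where
`rthorn(u)` is the number of descending edges of strict ancestors `v` of `u` lying to
the right of the path from `v` to `u`. -/
def rthornT : PTree → ℕ
  | .node ts => rthornL ts
def rthornL : List PTree → ℕ
  | [] => 0
  | t :: ts => rthornT t + ts.length * internCount t + rthornL ts
end

mutual
/-- The list of the values `lthorn(u)` for the internal nodes `u` of `T`, in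
contour-walk (preorder) order. -/
def lthornList : PTree → List ℕ
  | .node [] => []
  | .node (t :: ts) => 0 :: lthornLL 0 (t :: ts)
def lthornLL : ℕ → List PTree → List ℕ
  | _, [] => []
  | i, t :: ts => (lthornList t).map (· + i) ++ lthornLL (i + 1) ts
end

mutual
/-- The list of the values `rthorn(u)` for the internal nodes `u` of `T`, in
contour-walk (preorder) order. -/
def rthornList : PTree → List ℕ
  | .node [] => []
  | .node (t :: ts) => 0 :: rthornLL (t :: ts)
def rthornLL : List PTree → List ℕ
  | [] => []
  | t :: ts => (rthornList t).map (· + ts.length) ++ rthornLL ts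
end

/-! ## The bijections `λ` and `τ` -/

mutual
/-- `λ`: record each node of the tree at its first visit in the left-to-right contour
walk: `U_k` (i.e. `k`) for an internal node with `k+1` children, `D` (i.e. `-1`)
for a leaf. -/
def lambdaT : PTree → List ℤ
  | .node ts => ((ts.length : ℤ) - 1) :: lambdaL ts
def lambdaL : List PTree → List ℤ
  | [] => []
  | t :: ts => lambdaT t ++ lambdaL ts
end

/-- Auxiliary for `τ`: reading the path from right to left, maintain the stack of the
already-built subtrees (in left-to-right order); a down-step `D` creates a leaf and an
up-step `U_k` grabs the `k+1` topmost subtrees as its children.  This builds the same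
tree as the left-to-right "leftmost bud" construction. -/
def tauStack (P : List ℤ) : List PTree :=
  P.foldr (fun s st =>
    if s < 0 then PTree.node [] :: st
    else PTree.node (st.take (s.toNat + 1)) :: st.drop (s.toNat + 1)) []

/-- `τ`: the plane tree associated with a Łukasiewicz path. -/
def tau (P : List ℤ) : PTree := (tauStack P).headD (.node [])

mutual
/-- The mirror of a plane tree: reverse the left-to-right order of the children of
every internal node. -/
def mir : PTree → PTree
  | .node ts => .node (mirL ts).reverse
def mirL : List PTree → List PTree
  | [] => []
  | t :: ts => mir t :: mirL ts
end

mutual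
/-- The subtrees rooted at the internal nodes of `T`, in contour-walk (preorder)
order. -/
def internalSubtrees : PTree → List PTree
  | .node [] => []
  | .node (t :: ts) => .node (t :: ts) :: internalSubtreesL (t :: ts)
def internalSubtreesL : List PTree → List PTree
  | [] => []
  | t :: ts => internalSubtrees t ++ internalSubtreesL ts
end

/-- The multiset of degrees of the non-root internal nodes of `T`. -/
def nonRootInternalDegs (T : PTree) : Multiset ℕ :=
  (((internalSubtreesL (children T)).map numChildren : List ℕ) : Multiset ℕ)

/-! ## Lodestars and the lodestar swap -/

/-- A node is a lodestar-type node if it is internal and all its children are leaves. -/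
def isLodestarNode (t : PTree) : Bool :=
  !(children t).isEmpty && (children t).all (fun c => (children c).isEmpty)

mutual
/-- The subtree rooted at the *left lodestar* of `T`: the first internal node, in
contour-walk (preorder) order, all of whose children are leaves (if it exists). -/
def leftLode? : PTree → Option PTree
  | .node ts =>
    if isLodestarNode (.node ts) then some (.node ts) else leftLodeL? ts
def leftLodeL? : List PTree → Option PTree
  | [] => none
  | t :: ts =>
    match leftLode? t with
    | some r => some r
    | none => leftLodeL? ts
end

mutual
/-- The subtree rooted at the *right lodestar* of `T`: the last internal node, in
contour-walk (preorder) order, all of whose children are leaves (if it exists). -/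
def rightLode? : PTree → Option PTree
  | .node ts =>
    match rightLodeL? ts with
    | some r => some r
    | none => if isLodestarNode (.node ts) then some (.node ts) else none
def rightLodeL? : List PTree → Option PTree
  | [] => none
  | t :: ts =>
    match rightLodeL? ts with
    | some r => some r
    | none => rightLode? t
end

mutual
/-- Replace the left lodestar of `T` (first preorder all-leaf-children internal node)
by the tree `r`; `none` if `T` has no internal node. -/
def replF : PTree → PTree → Option PTree
  | r, .node ts =>
    if isLodestarNode (.node ts) then some r
    else (replFL r ts).map PTree.node
def replFL : PTree → List PTree → Option (List PTree)
  | _, [] => none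
  | r, t :: ts =>
    match replF r t with
    | some t' => some (t' :: ts)
    | none => (replFL r ts).map (t :: ·)
end

mutual
/-- Replace the right lodestar of `T` (last preorder all-leaf-children internal node)
by the tree `r`; `none` if `T` has no internal node. -/
def replL : PTree → PTree → Option PTree
  | r, .node ts =>
    match replLL r ts with
    | some ts' => some (.node ts')
    | none => if isLodestarNode (.node ts) then some r else none
def replLL : PTree → List PTree → Option (List PTree)
  | _, [] => none
  | r, t :: ts =>
    match replLL r ts with
    | some ts' => some (t :: ts')
    | none => (replL r t).map (· :: ts)
end

/-- The lodestar swap: exchange the subtrees rooted at the left lodestar and the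
right lodestar of `T` (each a node together with its pendant leaves). -/
def lodeSwap (T : PTree) : PTree :=
  match leftLode? T, rightLode? T with
  | some L, some R => ((replF R T).bind (replL L)).getD T
  | _, _ => T

end Luka

namespace Luka

/-- The word `Q` followed by an up-step of degree `a` and by the down-steps that bring the
path to height `-1`. -/
def appendUp (a : ℕ) (Q : List ℤ) : List ℤ :=
  Q ++ (a : ℤ) :: List.replicate (Q.sum.toNat + a + 1) (-1)

/-- The part of a word preceding the last step different from `D`. -/
def beforeLastUp (P : List ℤ) : List ℤ := (P.rdropWhile (· == -1)).dropLast

/-- `Q` uses steps `(1,k)` with `k ≥ -1` and stays weakly above the `x`-axis. -/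
def StaysNonneg (Q : List ℤ) : Prop :=
  (∀ s ∈ Q, -1 ≤ s) ∧ ∀ n ≤ Q.length, 0 ≤ (Q.take n).sum

lemma StaysNonneg.sum_nonneg {Q : List ℤ} (hQ : StaysNonneg Q) : 0 ≤ Q.sum := by
  simpa using hQ.2 Q.length le_rfl

lemma upDegs_append (P Q : List ℤ) : upDegs (P ++ Q) = upDegs P ++ upDegs Q := by
  simp [upDegs]

lemma upDegs_cons_of_nonneg {s : ℤ} (hs : 0 ≤ s) (P : List ℤ) :
    upDegs (s :: P) = s.toNat :: upDegs P := by
  simp [upDegs, hs]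

lemma upDegs_cons_of_neg {s : ℤ} (hs : s < 0) (P : List ℤ) : upDegs (s :: P) = upDegs P := by
  simp [upDegs, hs]

lemma upDegs_replicate_neg_one (m : ℕ) : upDegs (List.replicate m (-1)) = [] := by
  simp [upDegs]

lemma upDegs_append_cons_replicate (Q : List ℤ) (a m : ℕ) :
    upDegs (Q ++ (a : ℤ) :: List.replicate m (-1)) = upDegs Q ++ [a] := by
  rw [upDegs_append, upDegs_cons_of_nonneg (Int.natCast_nonneg a), upDegs_replicate_neg_one,
    Int.toNat_natCast]

lemma exists_eq_append_replicate_of_upDegs {P : List ℤ} {K : List ℕ} {a : ℕ}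
    (hP : ∀ s ∈ P, -1 ≤ s) (h : upDegs P = K ++ [a]) :
    ∃ (Q : List ℤ) (m : ℕ), P = Q ++ (a : ℤ) :: List.replicate m (-1) := by
  induction P using List.reverseRecOn with
  | nil => simp [upDegs] at h
  | append_singleton P s ih =>
    rw [upDegs_append] at h
    rcases lt_or_ge s 0 with hs | hs
    · obtain rfl : s = -1 := by have := hP s (by simp); omega
      rw [upDegs_cons_of_neg hs] at h
      obtain ⟨Q, m, rfl⟩ := ih (fun x hx => hP x (by simp [hx])) (by simpa [upDegs] using h)
      exact ⟨Q, m + 1, by simp [List.replicate_succ']⟩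
    · rw [upDegs_cons_of_nonneg hs] at h
      have hsa : s.toNat = a := by
        simpa [upDegs] using (List.append_inj' h (by simp [upDegs])).2
      exact ⟨P, 0, by simp [← hsa, hs]⟩

lemma beforeLastUp_append (Q : List ℤ) (a m : ℕ) :
    beforeLastUp (Q ++ (a : ℤ) :: List.replicate m (-1)) = Q := by
  have h : Q ++ (a : ℤ) :: List.replicate m (-1) =
      Q ++ [(a : ℤ)] ++ List.replicate m (-1) := by simp
  rw [h]
  induction m with
  | zero =>
    have ha : ¬((a : ℤ) == -1) = true := by simp
    rw [beforeLastUp, List.replicate_zero, List.append_nil,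
      List.rdropWhile_concat_neg (· == -1) _ _ ha, List.dropLast_concat]
  | succ m ih =>
    rw [List.replicate_succ', ← List.append_assoc]
    rw [beforeLastUp, List.rdropWhile_concat_pos _ _ _ (by simp)]
    exact ih (by simp)

lemma isLukas_append_cons_replicate_iff (Q : List ℤ) (a m : ℕ) :
    IsLukas (Q ++ (a : ℤ) :: List.replicate m (-1)) ↔
      StaysNonneg Q ∧ (m : ℤ) = Q.sum + a + 1 := by
  constructor
  · rintro ⟨-, hge, hpre, hsum⟩
    refine ⟨⟨fun s hs => hge s (by simp [hs]), fun n hn => ?_⟩, ?_⟩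
    · simpa [List.take_append_of_le_length hn] using hpre n (by simp; omega)
    · simp at hsum
      omega
  · rintro ⟨hQ, hm⟩
    refine ⟨by simp, fun s hs => ?_, fun n hn => ?_, ?_⟩
    · simp only [List.mem_append, List.mem_cons, List.mem_replicate] at hs
      rcases hs with hs | rfl | ⟨-, rfl⟩
      · exact hQ.1 s hs
      · omega
      · rfl
    · rcases le_or_gt n Q.length with h | h
      · rw [List.take_append_of_le_length h]
        exact hQ.2 n h
      · obtain ⟨j, rfl⟩ : ∃ j, n = Q.length + (j + 1) := ⟨n - Q.length - 1, by omega⟩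
        simp at hn
        have hj : min j m = j := by omega
        rw [List.take_length_add_append]
        simp [List.take_replicate, hj]
        omega
    · simp
      omega

lemma isLukas_and_upDegs_iff (K : List ℕ) (a : ℕ) (P : List ℤ) :
    IsLukas P ∧ upDegs P = K ++ [a] ↔
      ∃ Q, StaysNonneg Q ∧ upDegs Q = K ∧ P = appendUp a Q := by
  constructor
  · rintro ⟨hP, hK⟩
    obtain ⟨Q, m, rfl⟩ := exists_eq_append_replicate_of_upDegs hP.2.1 hK
    obtain ⟨hQ, hm⟩ := (isLukas_append_cons_replicate_iff Q a m).1 hP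
    rw [upDegs_append_cons_replicate] at hK
    refine ⟨Q, hQ, List.append_cancel_right hK, ?_⟩
    have := hQ.sum_nonneg
    rw [appendUp, show m = Q.sum.toNat + a + 1 by omega]
  · rintro ⟨Q, hQ, rfl, rfl⟩
    have := hQ.sum_nonneg
    exact ⟨(isLukas_append_cons_replicate_iff Q a _).2 ⟨hQ, by push_cast; omega⟩,
      upDegs_append_cons_replicate Q a _⟩

lemma areaVecAux_replicate_neg_one (h : ℤ) (m : ℕ) :
    areaVecAux h (List.replicate m (-1)) = [] := by
  induction m generalizing h with
  | zero => rfl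
  | succ m ih => simp [List.replicate_succ, areaVecAux, ih]

lemma areaVecAux_append_cons_replicate (h : ℤ) (Q : List ℤ) (a m : ℕ) :
    areaVecAux h (Q ++ (a : ℤ) :: List.replicate m (-1)) = areaVecAux h Q ++ [h + Q.sum] := by
  induction Q generalizing h with
  | nil => simp [areaVecAux, areaVecAux_replicate_neg_one]
  | cons s Q ih => simp [areaVecAux, ih, add_assoc]

lemma depthVecAux_replicate_neg_one (cur : ℕ) (stack : List ℕ) (m : ℕ) :
    depthVecAux cur stack (List.replicate m (-1)) = [] := by
  induction m generalizing cur stack with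
  | zero => rfl
  | succ m ih => cases stack <;> simp [List.replicate_succ, depthVecAux, ih]

lemma depthVecAux_append_cons_replicate (cur : ℕ) (stack : List ℕ) (Q : List ℤ)
    (a b m n : ℕ) :
    depthVecAux cur stack (Q ++ (a : ℤ) :: List.replicate m (-1)) =
      depthVecAux cur stack (Q ++ (b : ℤ) :: List.replicate n (-1)) := by
  induction Q generalizing cur stack with
  | nil => simp [depthVecAux, depthVecAux_replicate_neg_one]
  | cons s Q ih =>
    by_cases hs : 0 ≤ s
    · simp [depthVecAux, hs, ih]
    · cases stack <;> simp [depthVecAux, hs, ih]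

lemma area_appendUp (a b : ℕ) (Q : List ℤ) : area (appendUp a Q) = area (appendUp b Q) := by
  simp only [area, areaVec, appendUp, areaVecAux_append_cons_replicate]

lemma depth_appendUp (a b : ℕ) (Q : List ℤ) : depth (appendUp a Q) = depth (appendUp b Q) :=
  congrArg List.sum (depthVecAux_append_cons_replicate 0 [] Q a b _ _)

lemma beforeLastUp_appendUp (a : ℕ) (Q : List ℤ) : beforeLastUp (appendUp a Q) = Q :=
  beforeLastUp_append Q a _

end Luka

open Luka in
/-- **Proposition 4.6 (1).**  For any finite sequence `K` of naturals and any naturals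
`a, b`, the polynomials over Łukasiewicz paths with prescribed profile sequence satisfy
`C̃_{K·(a)}(q,t) = C̃_{K·(b)}(q,t)`, where `K·(a)` is `K` with `a` appended at the end.
The finite sets of Łukasiewicz paths with profile sequences `K ++ [a]` and `K ++ [b]`
are presented as arbitrary `Finset`s `Sa`, `Sb` with exactly those members. -/
theorem tildeC_profile_append_last (K : List ℕ) (a b : ℕ) {R : Type*} [CommSemiring R]
    (q t : R) (Sa Sb : Finset (List ℤ))
    (hSa : ∀ P, P ∈ Sa ↔ IsLukas P ∧ upDegs P = K ++ [a])
    (hSb : ∀ P, P ∈ Sb ↔ IsLukas P ∧ upDegs P = K ++ [b]) :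
    ∑ P ∈ Sa, q ^ area P * t ^ depth P = ∑ P ∈ Sb, q ^ area P * t ^ depth P := by
  simp only [isLukas_and_upDegs_iff] at hSa hSb
  refine Finset.sum_bij' (fun P _ => appendUp b (beforeLastUp P))
    (fun P _ => appendUp a (beforeLastUp P)) ?_ ?_ ?_ ?_ ?_
  · intro P hP
    obtain ⟨Q, hQ, hK, rfl⟩ := (hSa P).1 hP
    exact (hSb _).2 ⟨Q, hQ, hK, by rw [beforeLastUp_appendUp]⟩
  · intro P hP
    obtain ⟨Q, hQ, hK, rfl⟩ := (hSb P).1 hP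
    exact (hSa _).2 ⟨Q, hQ, hK, by rw [beforeLastUp_appendUp]⟩
  · intro P hP
    obtain ⟨Q, hQ, hK, rfl⟩ := (hSa P).1 hP
    simp only [beforeLastUp_appendUp]
  · intro P hP
    obtain ⟨Q, hQ, hK, rfl⟩ := (hSb P).1 hP
    simp only [beforeLastUp_appendUp]
  · intro P hP
    obtain ⟨Q, hQ, hK, rfl⟩ := (hSa P).1 hP
    simp only [beforeLastUp_appendUp, area_appendUp a b, depth_appendUp a b]
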